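/- arXiv:1202.6157 — 9 statements merged into one kernel-verified Lean document; each statement's English description precedes it below -/
import Mathlib

section
/- Let the number of players be K ≥ 1 and let the utility parameter satisfy β > K. If an action profile a has strictly more satisfied players than an action profile a' (i.e., S(a) > S(a')), then the social welfare of a is strictly larger than that of a', i.e., W(a) > W(a'). (Key step in the paper's Theorem 3: welfare comparisons are dominated by the number of satisfied players when β > K.) -/
open Finset

/-- SINR of player `k` at action profile `a` (each action is a power–channel pair). -/
noncomputable def sinr {K : ℕ} {Ch : Type} [Fintype Ch] [DecidableEq Ch]
    (g : Fin K → Fin K → Ch → ℝ) (σ2 : ℝ) (a : Fin K → ℝ × Ch) (k : Fin K) : ℝ :=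
  (a k).1 * g k k ((a k).2) /
    (σ2 + ∑ l ∈ Finset.univ.filter (fun l => l ≠ k ∧ (a l).2 = (a k).2),
      (a l).1 * g k l ((a k).2))

/-- Utility of player `k`. -/
noncomputable def util {K : ℕ} {Ch : Type} [Fintype Ch] [DecidableEq Ch]
    (g : Fin K → Fin K → Ch → ℝ) (σ2 Γ PMAX β : ℝ) (a : Fin K → ℝ × Ch) (k : Fin K) : ℝ :=
  (1 / (1 + β)) * ((PMAX - (a k).1) / PMAX + β * (if Γ ≤ sinr g σ2 a k then 1 else 0))

/-- Social welfare: the sum of the individual utilities. -/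
noncomputable def welfare {K : ℕ} {Ch : Type} [Fintype Ch] [DecidableEq Ch]
    (g : Fin K → Fin K → Ch → ℝ) (σ2 Γ PMAX β : ℝ) (a : Fin K → ℝ × Ch) : ℝ :=
  ∑ k, util g σ2 Γ PMAX β a k

/-- Number of satisfied players at profile `a`. -/
noncomputable def numSat {K : ℕ} {Ch : Type} [Fintype Ch] [DecidableEq Ch]
    (g : Fin K → Fin K → Ch → ℝ) (σ2 Γ : ℝ) (a : Fin K → ℝ × Ch) : ℕ :=
  (Finset.univ.filter (fun k => Γ ≤ sinr g σ2 a k)).card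

/-- Welfare splits into the total normalized power saving plus `β` times the number of satisfied
players. -/
theorem welfare_eq {K : ℕ} {Ch : Type} [Fintype Ch] [DecidableEq Ch]
    (g : Fin K → Fin K → Ch → ℝ) (σ2 Γ PMAX β : ℝ) (a : Fin K → ℝ × Ch) :
    welfare g σ2 Γ PMAX β a =
      (1 / (1 + β)) * (∑ k, (PMAX - (a k).1) / PMAX + β * (numSat g σ2 Γ a : ℝ)) := by
  simp only [welfare, util, numSat, ← Finset.mul_sum, Finset.sum_add_distrib, Finset.sum_boole]

/-- The total normalized power saving is nonnegative. -/
theorem sum_saving_nonneg {K : ℕ} {Ch : Type} {PMAX : ℝ} (hP : 0 < PMAX)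
    (a : Fin K → ℝ × Ch) (ha : ∀ k, (a k).1 ≤ PMAX) :
    0 ≤ ∑ k, (PMAX - (a k).1) / PMAX :=
  Finset.sum_nonneg fun k _ => div_nonneg (sub_nonneg.2 (ha k)) hP.le

/-- The total normalized power saving is at most the number of players. -/
theorem sum_saving_le {K : ℕ} {Ch : Type} {PMAX : ℝ} (hP : 0 < PMAX)
    (a : Fin K → ℝ × Ch) (ha : ∀ k, 0 ≤ (a k).1) :
    ∑ k, (PMAX - (a k).1) / PMAX ≤ K := by
  have h : ∀ k ∈ Finset.univ, (PMAX - (a k).1) / PMAX ≤ 1 := fun k _ =>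
    (div_le_one hP).2 (sub_le_self _ (ha k))
  simpa using Finset.sum_le_sum h

/-- with `β > K`, a profile with strictly more satisfied players has strictly
larger social welfare. -/
theorem stmt0
    (K : ℕ) (hK : 1 ≤ K)
    (Ch : Type) [Fintype Ch] [DecidableEq Ch]
    (Pow : Finset ℝ) (hPow0 : (0 : ℝ) ∈ Pow) (hPownn : ∀ x ∈ Pow, 0 ≤ x)
    (PMAX : ℝ) (hPmem : PMAX ∈ Pow) (hPub : ∀ x ∈ Pow, x ≤ PMAX) (hPpos : 0 < PMAX)
    (g : Fin K → Fin K → Ch → ℝ) (hg : ∀ k l b, 0 ≤ g k l b) (hgd : ∀ k b, 0 < g k k b)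
    (σ2 : ℝ) (hσ : 0 < σ2) (Γ : ℝ) (hΓ : 0 < Γ)
    (β : ℝ) (hβ : (K : ℝ) < β)
    (a a' : Fin K → ℝ × Ch) (ha : ∀ k, (a k).1 ∈ Pow) (ha' : ∀ k, (a' k).1 ∈ Pow)
    (hS : numSat g σ2 Γ a' < numSat g σ2 Γ a) :
    welfare g σ2 Γ PMAX β a' < welfare g σ2 Γ PMAX β a := by
  have hβ0 : 0 < β := lt_of_le_of_lt (Nat.cast_nonneg K) hβ
  rw [welfare_eq, welfare_eq]
  refine mul_lt_mul_of_pos_left ?_ (by positivity)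
  have h0 := sum_saving_nonneg hPpos a fun k => hPub _ (ha k)
  have h1 := sum_saving_le hPpos a' fun k => hPownn _ (ha' k)
  have hS' : (numSat g σ2 Γ a' : ℝ) + 1 ≤ numSat g σ2 Γ a := by exact_mod_cast hS
  have h2 := mul_le_mul_of_nonneg_left hS' hβ0.le
  linarith
end

section
/- Let a* be a pure Nash equilibrium of the normal-form game at which every player is satisfied. Then a* is an efficient satisfaction equilibrium: every player is satisfied at a*, and for every player k, every alternative action a'_k = (p', b') such that player k is satisfied at (a'_k, a*_{−k}) has p' ≥ p*_k. (Part of the paper's Theorem 4 linking Nash equilibria of the normal-form game G with efficient satisfaction equilibria of the satisfaction-form game G' under effort Φ_k(a_k) = p_k.) -/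
open Finset

/-- a pure Nash equilibrium at which every player is satisfied is an efficient
satisfaction equilibrium (with effort equal to the transmit power). -/
theorem stmt3
    (K : ℕ) (hK : 1 ≤ K)
    (Ch : Type) [Fintype Ch] [DecidableEq Ch]
    (Pow : Finset ℝ) (hPow0 : (0 : ℝ) ∈ Pow) (hPownn : ∀ x ∈ Pow, 0 ≤ x)
    (PMAX : ℝ) (hPmem : PMAX ∈ Pow) (hPub : ∀ x ∈ Pow, x ≤ PMAX) (hPpos : 0 < PMAX)
    (g : Fin K → Fin K → Ch → ℝ) (hg : ∀ k l b, 0 ≤ g k l b) (hgd : ∀ k b, 0 < g k k b)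
    (σ2 : ℝ) (hσ : 0 < σ2) (Γ : ℝ) (hΓ : 0 < Γ)
    (β : ℝ) (hβ : 0 < β)
    (astar : Fin K → ℝ × Ch) (hastar : ∀ k, (astar k).1 ∈ Pow)
    (hNE : ∀ (k : Fin K) (ak' : ℝ × Ch), ak'.1 ∈ Pow →
      util g σ2 Γ PMAX β (Function.update astar k ak') k ≤ util g σ2 Γ PMAX β astar k)
    (hsat : ∀ k, Γ ≤ sinr g σ2 astar k) :
    (∀ k, Γ ≤ sinr g σ2 astar k) ∧
      ∀ (k : Fin K) (p' : ℝ) (b' : Ch), p' ∈ Pow →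
        Γ ≤ sinr g σ2 (Function.update astar k (p', b')) k → (astar k).1 ≤ p' := by
  refine ⟨hsat, fun k p' b' hp' hs => ?_⟩
  have h := hNE k (p', b') hp'
  have hβ1 : 0 < 1 / (1 + β) := by positivity
  simp only [util, if_pos hs, if_pos (hsat k), Function.update_self] at h
  have h' := le_of_add_le_add_right (le_of_mul_le_mul_left h hβ1)
  rw [div_le_div_iff_of_pos_right hPpos] at h'
  linarith
end

section
/- Assume β ≥ 1. Let a* be an efficient satisfaction equilibrium: every player is satisfied at a*, and for every player k, every alternative action a'_k = (p', b') such that player k is satisfied at (a'_k, a*_{−k}) has p' ≥ p*_k. Then a* is a pure Nash equilibrium of the normal-form game, i.e., for every k and every a'_k ∈ P × C, u_k(a'_k, a*_{−k}) ≤ u_k(a*). (Converse direction of the paper's identification of its learning outcome as both a Nash equilibrium and an efficient satisfaction equilibrium.) -/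
open Finset

/-- with `β ≥ 1`, an efficient satisfaction equilibrium is a pure Nash
equilibrium of the normal-form game. -/
theorem stmt4
    (K : ℕ) (hK : 1 ≤ K)
    (Ch : Type) [Fintype Ch] [DecidableEq Ch]
    (Pow : Finset ℝ) (hPow0 : (0 : ℝ) ∈ Pow) (hPownn : ∀ x ∈ Pow, 0 ≤ x)
    (PMAX : ℝ) (hPmem : PMAX ∈ Pow) (hPub : ∀ x ∈ Pow, x ≤ PMAX) (hPpos : 0 < PMAX)
    (g : Fin K → Fin K → Ch → ℝ) (hg : ∀ k l b, 0 ≤ g k l b) (hgd : ∀ k b, 0 < g k k b)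
    (σ2 : ℝ) (hσ : 0 < σ2) (Γ : ℝ) (hΓ : 0 < Γ)
    (β : ℝ) (hβ : 1 ≤ β)
    (astar : Fin K → ℝ × Ch) (hastar : ∀ k, (astar k).1 ∈ Pow)
    (hsat : ∀ k, Γ ≤ sinr g σ2 astar k)
    (hESE : ∀ (k : Fin K) (p' : ℝ) (b' : Ch), p' ∈ Pow →
      Γ ≤ sinr g σ2 (Function.update astar k (p', b')) k → (astar k).1 ≤ p') :
    ∀ (k : Fin K) (ak' : ℝ × Ch), ak'.1 ∈ Pow →
      util g σ2 Γ PMAX β (Function.update astar k ak') k ≤ util g σ2 Γ PMAX β astar k := by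
  intro k ⟨p', b'⟩ hp'
  unfold util
  have hp0 := hPownn p' hp'
  have hkmax := hPub _ (hastar k)
  refine mul_le_mul_of_nonneg_left ?_ (by positivity)
  rw [if_pos (hsat k), Function.update_self]
  split_ifs with h
  · have hle := hESE k p' b' hp' h
    gcongr
  · have h1 : (PMAX - p') / PMAX ≤ 1 := (div_le_one hPpos).2 (by linarith)
    have h2 : 0 ≤ (PMAX - (astar k).1) / PMAX := div_nonneg (by linarith) hPpos.le
    dsimp only
    linarith
end

section
/- Under the simplified channel model (all direct gains equal 1 and all cross gains equal 1/2 on every channel), assume |C| ≥ K and assume the power set P contains a level ≥ Γσ²; let p* be the smallest element of P with p* ≥ Γσ². Then the profile a* in which the K players use pairwise distinct channels and each transmits at power p* is an efficient satisfaction equilibrium: every player is satisfied at a*, and for every player k, any action (p', b') keeping player k satisfied against a*_{−k} has p' ≥ p*. -/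
open Finset

/-- SINR of player `k` under the simplified channel model: direct gains `1`, cross gains
`1/2` on every channel. -/
noncomputable def sinrS {K : ℕ} {Ch : Type} [Fintype Ch] [DecidableEq Ch]
    (σ2 : ℝ) (a : Fin K → ℝ × Ch) (k : Fin K) : ℝ :=
  (a k).1 /
    (σ2 + ∑ l ∈ Finset.univ.filter (fun l => l ≠ k ∧ (a l).2 = (a k).2), (a l).1 / 2)

/-- A player whose SINR reaches `Γ` transmits at power at least `Γ * σ2`. -/
theorem mul_le_of_le_sinrS {K : ℕ} {Ch : Type} [Fintype Ch] [DecidableEq Ch]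
    {σ2 Γ : ℝ} (hσ : 0 < σ2) (hΓ : 0 ≤ Γ) {a : Fin K → ℝ × Ch} (k : Fin K)
    (ha : ∀ l, 0 ≤ (a l).1) (h : Γ ≤ sinrS σ2 a k) : Γ * σ2 ≤ (a k).1 := by
  have hsum : 0 ≤ ∑ l ∈ Finset.univ.filter (fun l => l ≠ k ∧ (a l).2 = (a k).2),
      (a l).1 / 2 :=
    Finset.sum_nonneg fun l _ => div_nonneg (ha l) zero_le_two
  have hle := (le_div_iff₀ (by positivity)).mp h
  exact (mul_le_mul_of_nonneg_left (le_add_of_nonneg_right hsum) hΓ).trans hle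

/-- under the simplified channel model with at least as many channels as
players, the profile where players use pairwise distinct channels and each transmits at the
smallest power level `p* ≥ Γσ²` is an efficient satisfaction equilibrium. -/
theorem stmt6
    (K : ℕ) (hK : 1 ≤ K)
    (Ch : Type) [Fintype Ch] [DecidableEq Ch] (hC : K ≤ Fintype.card Ch)
    (Pow : Finset ℝ) (hPow0 : (0 : ℝ) ∈ Pow) (hPownn : ∀ x ∈ Pow, 0 ≤ x)
    (PMAX : ℝ) (hPmem : PMAX ∈ Pow) (hPub : ∀ x ∈ Pow, x ≤ PMAX) (hPpos : 0 < PMAX)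
    (σ2 : ℝ) (hσ : 0 < σ2) (Γ : ℝ) (hΓ : 0 < Γ)
    (pstar : ℝ) (hpmem : pstar ∈ Pow) (hpge : Γ * σ2 ≤ pstar)
    (hpmin : ∀ q ∈ Pow, Γ * σ2 ≤ q → pstar ≤ q)
    (b : Fin K → Ch) (hb : Function.Injective b)
    (astar : Fin K → ℝ × Ch) (hastar : astar = fun k => (pstar, b k)) :
    (∀ k, Γ ≤ sinrS σ2 astar k) ∧
      ∀ (k : Fin K) (p' : ℝ) (b' : Ch), p' ∈ Pow →
        Γ ≤ sinrS σ2 (Function.update astar k (p', b')) k → pstar ≤ p' := by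
  subst hastar
  refine ⟨fun k => ?_, fun k p' b' hp' h => hpmin p' hp' ?_⟩
  · have hempty : Finset.univ.filter (fun l => l ≠ k ∧ b l = b k) = ∅ :=
      Finset.filter_eq_empty_iff.mpr fun l _ hl => hl.1 (hb hl.2)
    simp only [sinrS, hempty, Finset.sum_empty, add_zero]
    exact (le_div_iff₀ hσ).mpr hpge
  · refine mul_le_of_le_sinrS hσ hΓ.le k (fun l => ?_) h |>.trans_eq (by simp)
    rcases eq_or_ne l k with rfl | hl
    · simpa using hPownn p' hp'
    · simpa [Function.update_of_ne hl] using hPownn pstar hpmem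
end

section
/- Under the simplified channel model (all direct gains equal 1 and all cross gains equal 1/2 on every channel), assume |C| ≥ K and assume P contains a level ≥ Γσ²; let p* be the smallest element of P with p* ≥ Γσ². Then: (i) every action profile at which all K players are satisfied has total power Σ_k p_k ≥ K·p*; and (ii) the profile a* in which the players use pairwise distinct channels and each transmits at power p* satisfies all K players with total power exactly K·p*. Hence a* solves the global optimization problem of minimizing total transmit power subject to all K SINR constraints. -/
open Finset

/-- Interference is nonnegative, so a satisfied player transmits at least `Γ * σ2`. -/
theorem mul_noise_le_power_of_le_sinrS {K : ℕ} {Ch : Type} [Fintype Ch] [DecidableEq Ch]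
    {σ2 Γ : ℝ} (hσ : 0 < σ2) (hΓ : 0 ≤ Γ) {a : Fin K → ℝ × Ch} (ha : ∀ k, 0 ≤ (a k).1)
    {k : Fin K} (hk : Γ ≤ sinrS σ2 a k) : Γ * σ2 ≤ (a k).1 := by
  have hI : 0 ≤ ∑ l ∈ Finset.univ.filter (fun l => l ≠ k ∧ (a l).2 = (a k).2), (a l).1 / 2 :=
    Finset.sum_nonneg fun l _ => div_nonneg (ha l) zero_le_two
  rw [sinrS, le_div_iff₀ (by linarith)] at hk
  exact (mul_le_mul_of_nonneg_left (le_add_of_nonneg_right hI) hΓ).trans hk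

/-- On pairwise distinct channels there is no interference. -/
theorem sinrS_of_injective {K : ℕ} {Ch : Type} [Fintype Ch] [DecidableEq Ch]
    (σ2 : ℝ) {a : Fin K → ℝ × Ch} (ha : Function.Injective fun k => (a k).2) (k : Fin K) :
    sinrS σ2 a k = (a k).1 / σ2 := by
  have h : Finset.univ.filter (fun l => l ≠ k ∧ (a l).2 = (a k).2) = ∅ :=
    Finset.filter_eq_empty_iff.2 fun l _ hl => hl.1 (ha hl.2)
  rw [sinrS, h, Finset.sum_empty, add_zero]

/-- under the simplified channel model, (i) every fully-satisfied profile uses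
total power at least `K·p*`, and (ii) the distinct-channel profile at power `p*` satisfies
all players with total power exactly `K·p*`; hence it solves the global power-minimization
problem. -/
theorem stmt7
    (K : ℕ) (hK : 1 ≤ K)
    (Ch : Type) [Fintype Ch] [DecidableEq Ch] (hC : K ≤ Fintype.card Ch)
    (Pow : Finset ℝ) (hPow0 : (0 : ℝ) ∈ Pow) (hPownn : ∀ x ∈ Pow, 0 ≤ x)
    (PMAX : ℝ) (hPmem : PMAX ∈ Pow) (hPub : ∀ x ∈ Pow, x ≤ PMAX) (hPpos : 0 < PMAX)
    (σ2 : ℝ) (hσ : 0 < σ2) (Γ : ℝ) (hΓ : 0 < Γ)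
    (pstar : ℝ) (hpmem : pstar ∈ Pow) (hpge : Γ * σ2 ≤ pstar)
    (hpmin : ∀ q ∈ Pow, Γ * σ2 ≤ q → pstar ≤ q)
    (b : Fin K → Ch) (hb : Function.Injective b)
    (astar : Fin K → ℝ × Ch) (hastar : astar = fun k => (pstar, b k)) :
    (∀ a : Fin K → ℝ × Ch, (∀ k, (a k).1 ∈ Pow) → (∀ k, Γ ≤ sinrS σ2 a k) →
        (K : ℝ) * pstar ≤ ∑ k, (a k).1) ∧
      (∀ k, Γ ≤ sinrS σ2 astar k) ∧ ∑ k, (astar k).1 = (K : ℝ) * pstar := by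
  subst hastar
  refine ⟨fun a ha hs => ?_, fun k => ?_, by simp⟩
  · have h : ∀ k ∈ Finset.univ, pstar ≤ (a k).1 := fun k _ =>
      hpmin _ (ha k) (mul_noise_le_power_of_le_sinrS hσ hΓ.le (fun l => hPownn _ (ha l)) (hs k))
    simpa using Finset.card_nsmul_le_sum Finset.univ _ _ h
  · rw [sinrS_of_injective σ2 hb, le_div_iff₀ hσ]
    exact hpge
end

section
/- Under the simplified channel model (all direct gains equal 1 and all cross gains equal 1/2 on every channel), assume |C| ≥ K, assume P contains a level ≥ Γσ² and let p* be the smallest element of P with p* ≥ Γσ², and assume β ≥ 1. Then the profile a* in which the K players use pairwise distinct channels and each transmits at power p* is a pure Nash equilibrium of the normal-form game: for every player k and every alternative action a'_k ∈ P × C, u_k(a'_k, a*_{−k}) ≤ u_k(a*). (This establishes that the set of Nash equilibria intersected with the solutions of the power-minimization problem is nonempty, as assumed in the paper's Theorem 4 and guaranteed by its Corollary 1.) -/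
open Finset

/-- Utility of player `k` under the simplified channel model. -/
noncomputable def utilS {K : ℕ} {Ch : Type} [Fintype Ch] [DecidableEq Ch]
    (σ2 Γ PMAX β : ℝ) (a : Fin K → ℝ × Ch) (k : Fin K) : ℝ :=
  (1 / (1 + β)) * ((PMAX - (a k).1) / PMAX + β * (if Γ ≤ sinrS σ2 a k then 1 else 0))

/-- under the simplified channel model with `|C| ≥ K` and `β ≥ 1`, the
distinct-channel profile at the smallest satisfying power `p*` is a pure Nash equilibrium. -/
theorem stmt8
    (K : ℕ) (hK : 1 ≤ K)
    (Ch : Type) [Fintype Ch] [DecidableEq Ch] (hC : K ≤ Fintype.card Ch)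
    (Pow : Finset ℝ) (hPow0 : (0 : ℝ) ∈ Pow) (hPownn : ∀ x ∈ Pow, 0 ≤ x)
    (PMAX : ℝ) (hPmem : PMAX ∈ Pow) (hPub : ∀ x ∈ Pow, x ≤ PMAX) (hPpos : 0 < PMAX)
    (σ2 : ℝ) (hσ : 0 < σ2) (Γ : ℝ) (hΓ : 0 < Γ)
    (β : ℝ) (hβ : 1 ≤ β)
    (pstar : ℝ) (hpmem : pstar ∈ Pow) (hpge : Γ * σ2 ≤ pstar)
    (hpmin : ∀ q ∈ Pow, Γ * σ2 ≤ q → pstar ≤ q)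
    (b : Fin K → Ch) (hb : Function.Injective b)
    (astar : Fin K → ℝ × Ch) (hastar : astar = fun k => (pstar, b k)) :
    ∀ (k : Fin K) (ak' : ℝ × Ch), ak'.1 ∈ Pow →
      utilS σ2 Γ PMAX β (Function.update astar k ak') k ≤ utilS σ2 Γ PMAX β astar k := by
  subst hastar
  intro k ak' hak
  have hinterf : ∑ l ∈ Finset.univ.filter (fun l => l ≠ k ∧ b l = b k), pstar / 2 = 0 := by
    apply Finset.sum_eq_zero
    intro l hl
    obtain ⟨hlk, hbl⟩ := (Finset.mem_filter.mp hl).2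
    exact absurd (hb hbl) hlk
  have hsat : Γ ≤ sinrS σ2 (fun k => (pstar, b k)) k := by
    unfold sinrS
    simp only [hinterf, add_zero]
    rwa [le_div_iff₀ hσ]
  have hdev : Γ ≤ sinrS σ2 (Function.update (fun k => (pstar, b k)) k ak') k →
      pstar ≤ ak'.1 := by
    intro h
    apply hpmin _ hak
    unfold sinrS at h
    rw [Function.update_self] at h
    have hnn : 0 ≤ ∑ l ∈ Finset.univ.filter (fun l => l ≠ k ∧
        (Function.update (fun k => (pstar, b k)) k ak' l).2 = ak'.2),
        (Function.update (fun k => (pstar, b k)) k ak' l).1 / 2 := by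
      apply Finset.sum_nonneg
      intro l hl
      rw [Function.update_of_ne (Finset.mem_filter.mp hl).2.1]
      exact div_nonneg (hPownn _ hpmem) zero_le_two
    rw [le_div_iff₀ (by linarith)] at h
    exact (mul_le_mul_of_nonneg_left (le_add_of_nonneg_right hnn) hΓ.le).trans h
  unfold utilS
  rw [if_pos hsat, Function.update_self]
  refine mul_le_mul_of_nonneg_left ?_ (by positivity)
  split_ifs with h
  · have := hdev h
    gcongr
  · have hle : (PMAX - ak'.1) / PMAX ≤ 1 :=
      (div_le_one hPpos).mpr (sub_le_self _ (hPownn _ hak))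
    have hge : 0 ≤ (PMAX - pstar) / PMAX :=
      div_nonneg (sub_nonneg.mpr (hPub _ hpmem)) hPpos.le
    linarith
end

section
/- Let a* be an action profile maximizing the social welfare W over all action profiles. Then every player who is unsatisfied at a* transmits at zero power: for every k with SINR_k(a*) < Γ, one has p*_k = 0. (Intermediate claim underlying the paper's Theorem 5: in the welfare-optimal configuration selected by trial-and-error learning, unsatisfied players employ zero power.) -/
open Finset

/-- Switching off player `k` weakly increases the SINR of every other player. -/
theorem sinr_le_sinr_update_zero {K : ℕ} {Ch : Type} [Fintype Ch] [DecidableEq Ch]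
    {g : Fin K → Fin K → Ch → ℝ} (hg : ∀ k l b, 0 ≤ g k l b) {σ2 : ℝ} (hσ : 0 < σ2)
    {a : Fin K → ℝ × Ch} (ha : ∀ k, 0 ≤ (a k).1) {k j : Fin K} (hjk : j ≠ k) :
    sinr g σ2 a j ≤ sinr g σ2 (Function.update a k (0, (a k).2)) j := by
  have hch : ∀ l, (Function.update a k (0, (a k).2) l).2 = (a l).2 := by
    intro l
    rcases eq_or_ne l k with rfl | h <;> simp [*]
  have hpow : ∀ l, 0 ≤ (Function.update a k (0, (a k).2) l).1 ∧
      (Function.update a k (0, (a k).2) l).1 ≤ (a l).1 := by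
    intro l
    rcases eq_or_ne l k with rfl | h <;> simp [*]
  have hj : (Function.update a k (0, (a k).2) j).1 = (a j).1 := by simp [hjk]
  unfold sinr
  simp only [hch, hj]
  apply div_le_div_of_nonneg_left (mul_nonneg (ha j) (hg _ _ _))
  · exact add_pos_of_pos_of_nonneg hσ
      (Finset.sum_nonneg fun l _ => mul_nonneg (hpow l).1 (hg _ _ _))
  · gcongr with l _
    · exact hg _ _ _
    · exact (hpow l).2

/-- Utility is monotone in the SINR at equal transmit power. -/
theorem util_le_util {K : ℕ} {Ch : Type} [Fintype Ch] [DecidableEq Ch]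
    {g : Fin K → Fin K → Ch → ℝ} {σ2 Γ PMAX β : ℝ} (hβ : 0 < β) {a a' : Fin K → ℝ × Ch}
    {j : Fin K} (hp : (a' j).1 = (a j).1) (hs : sinr g σ2 a j ≤ sinr g σ2 a' j) :
    util g σ2 Γ PMAX β a j ≤ util g σ2 Γ PMAX β a' j := by
  unfold util
  rw [hp]
  gcongr
  split_ifs with h h'
  · rfl
  · exact absurd (h.trans hs) h'
  · exact zero_le_one
  · rfl

/-- An unsatisfied player strictly gains by lowering its transmit power. -/
theorem util_lt_util_of_unsatisfied {K : ℕ} {Ch : Type} [Fintype Ch] [DecidableEq Ch]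
    {g : Fin K → Fin K → Ch → ℝ} {σ2 Γ PMAX β : ℝ} (hP : 0 < PMAX) (hβ : 0 < β)
    {a a' : Fin K → ℝ × Ch} {k : Fin K} (hs : sinr g σ2 a k < Γ) (hp : (a' k).1 < (a k).1) :
    util g σ2 Γ PMAX β a k < util g σ2 Γ PMAX β a' k := by
  unfold util
  rw [if_neg hs.not_ge]
  apply mul_lt_mul_of_pos_left _ (by positivity)
  apply add_lt_add_of_lt_of_le
  · gcongr
  · gcongr
    split_ifs <;> norm_num

/-- at a welfare-maximizing profile, every unsatisfied player transmits at
zero power. -/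
theorem stmt9
    (K : ℕ) (hK : 1 ≤ K)
    (Ch : Type) [Fintype Ch] [DecidableEq Ch]
    (Pow : Finset ℝ) (hPow0 : (0 : ℝ) ∈ Pow) (hPownn : ∀ x ∈ Pow, 0 ≤ x)
    (PMAX : ℝ) (hPmem : PMAX ∈ Pow) (hPub : ∀ x ∈ Pow, x ≤ PMAX) (hPpos : 0 < PMAX)
    (g : Fin K → Fin K → Ch → ℝ) (hg : ∀ k l b, 0 ≤ g k l b) (hgd : ∀ k b, 0 < g k k b)
    (σ2 : ℝ) (hσ : 0 < σ2) (Γ : ℝ) (hΓ : 0 < Γ)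
    (β : ℝ) (hβ : 0 < β)
    (astar : Fin K → ℝ × Ch) (hastar : ∀ k, (astar k).1 ∈ Pow)
    (hmax : ∀ a : Fin K → ℝ × Ch, (∀ k, (a k).1 ∈ Pow) →
      welfare g σ2 Γ PMAX β a ≤ welfare g σ2 Γ PMAX β astar) :
    ∀ k : Fin K, sinr g σ2 astar k < Γ → (astar k).1 = 0 := by
  intro k hk
  by_contra hne
  have hnn : ∀ l, 0 ≤ (astar l).1 := fun l => hPownn _ (hastar l)
  refine (hmax (Function.update astar k (0, (astar k).2)) fun l => ?_).not_gt ?_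
  · rcases eq_or_ne l k with rfl | h <;> simp [*]
  have hlt : util g σ2 Γ PMAX β astar k <
      util g σ2 Γ PMAX β (Function.update astar k (0, (astar k).2)) k :=
    util_lt_util_of_unsatisfied hPpos hβ hk (by simpa using (hnn k).lt_of_ne' hne)
  refine Finset.sum_lt_sum (fun j _ => ?_) ⟨k, Finset.mem_univ k, hlt⟩
  rcases eq_or_ne j k with rfl | hjk
  · exact hlt.le
  · exact util_le_util hβ (by simp [hjk]) (sinr_le_sinr_update_zero hg hσ hnn hjk)
end

section
/- Let K, C, Q be natural numbers with 1 ≤ K < C and Q ≥ 1, let ε ∈ (0,1) and let g ∈ (0, 1/2). Define T := Σ_{k=0}^{K−1} CQ / (ε^{1+g}·(K−k)·(C−k)) (the expected absorption time of the pure-birth Markov chain whose transition probability from state C_{K−k} to C_{K−k−1} is (K−k)(C−k)ε^{1+g}/(CQ)). Then T ≤ (CQ / (ε^{1+g}(C−K)))·(1 + log(K(C−K+1)/(C+1))) and T ≥ (CQ / (ε^{1+g}(C−K)))·(γ + log(K(C−K)/C)), where γ is the Euler–Mascheroni constant. (The paper's Theorem 6: bounds on the expected number of iterations for trial-and-error learning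 to reach a Nash equilibrium for the first time.) -/
theorem log_add_one_sub_log_le_inv {a : ℝ} (ha : 0 < a) :
    Real.log (a + 1) - Real.log a ≤ a⁻¹ := by
  rw [← Real.log_div (by positivity) ha.ne']
  have h := Real.log_le_sub_one_of_pos (show 0 < (a + 1) / a by positivity)
  have e : (a + 1) / a - 1 = a⁻¹ := by field_simp; ring
  rwa [e] at h

theorem inv_add_one_le_log_add_one_sub_log {a : ℝ} (ha : 0 < a) :
    (a + 1)⁻¹ ≤ Real.log (a + 1) - Real.log a := by
  rw [← Real.log_div (by positivity) ha.ne']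
  have h := Real.one_sub_inv_le_log_of_pos (show 0 < (a + 1) / a by positivity)
  have e : 1 - ((a + 1) / a)⁻¹ = (a + 1)⁻¹ := by field_simp; ring
  rwa [e] at h

theorem log_sub_log_le_sum_inv {d : ℝ} (hd : 0 < d) (n : ℕ) :
    Real.log (d + n + 1) - Real.log (d + 1) ≤ ∑ j ∈ Finset.range n, (d + j + 1)⁻¹ := by
  induction n with
  | zero => simp
  | succ n ih =>
    rw [Finset.sum_range_succ]
    have h := log_add_one_sub_log_le_inv (show 0 < d + n + 1 by positivity)
    push_cast
    rw [← add_assoc d]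
    linarith

theorem sum_inv_le_log_sub_log {d : ℝ} (hd : 0 < d) (n : ℕ) :
    ∑ j ∈ Finset.range n, (d + j + 1)⁻¹ ≤ Real.log (d + n) - Real.log d := by
  induction n with
  | zero => simp
  | succ n ih =>
    rw [Finset.sum_range_succ]
    have h := inv_add_one_le_log_add_one_sub_log (show 0 < d + n by positivity)
    push_cast
    rw [← add_assoc d]
    linarith

theorem eulerMascheroniConstant_add_log_le_harmonic {n : ℕ} (hn : n ≠ 0) :
    Real.eulerMascheroniConstant + Real.log n ≤ harmonic n := by
  have h := Real.eulerMascheroniConstant_lt_eulerMascheroniSeq' n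
  rw [Real.eulerMascheroniSeq', if_neg hn] at h
  linarith

theorem sum_div_mul_add_eq {d : ℝ} (hd : 0 < d) (a E : ℝ) (n : ℕ) :
    ∑ k ∈ Finset.range n, a / (E * ((n : ℝ) - k) * (d + n - k)) =
      a / (E * d) * (harmonic n - ∑ j ∈ Finset.range n, (d + j + 1)⁻¹) := by
  rw [← Finset.sum_range_reflect, harmonic]
  push_cast
  rw [← Finset.sum_sub_distrib, Finset.mul_sum]
  refine Finset.sum_congr rfl fun j hj => ?_
  have hj : j + 1 ≤ n := Finset.mem_range.mp hj
  rw [Nat.sub_sub, add_comm 1 j, Nat.cast_sub hj]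
  push_cast
  rw [show (n : ℝ) - (n - (j + 1)) = j + 1 by ring,
    show d + n - (n - ((j : ℝ) + 1)) = d + j + 1 by ring]
  rcases eq_or_ne E 0 with rfl | hE
  · simp
  have h1 : (j : ℝ) + 1 ≠ 0 := by positivity
  have h2 : d + j + 1 ≠ 0 := by positivity
  field_simp
  ring



/-- paper's Theorem 6: bounds on the expected absorption time of the
pure-birth Markov chain approximating trial-and-error learning until the Nash equilibrium
is reached for the first time. -/
theorem stmt11
    (K C Q : ℕ) (hK : 1 ≤ K) (hKC : K < C) (hQ : 1 ≤ Q)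
    (ε : ℝ) (hε0 : 0 < ε) (hε1 : ε < 1)
    (g : ℝ) (hg0 : 0 < g) (hg1 : g < 1 / 2)
    (T : ℝ)
    (hT : T = ∑ k ∈ Finset.range K,
      (C : ℝ) * Q / (ε ^ ((1 : ℝ) + g) * ((K : ℝ) - k) * ((C : ℝ) - k))) :
    T ≤ (C : ℝ) * Q / (ε ^ ((1 : ℝ) + g) * ((C : ℝ) - K)) *
        (1 + Real.log ((K : ℝ) * ((C : ℝ) - K + 1) / ((C : ℝ) + 1))) ∧
      (C : ℝ) * Q / (ε ^ ((1 : ℝ) + g) * ((C : ℝ) - K)) *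
        (Real.eulerMascheroniConstant + Real.log ((K : ℝ) * ((C : ℝ) - K) / C)) ≤ T := by
  have hd : (0 : ℝ) < (C : ℝ) - K := sub_pos.mpr (by exact_mod_cast hKC)
  have hK0 : (0 : ℝ) < K := by exact_mod_cast hK
  have hC0 : (0 : ℝ) < C := by linarith
  have hE : 0 < ε ^ ((1 : ℝ) + g) := Real.rpow_pos_of_pos hε0 _
  have hsum := sum_div_mul_add_eq hd ((C : ℝ) * Q) (ε ^ ((1 : ℝ) + g)) K
  have hlow := log_sub_log_le_sum_inv hd K
  have hupp := sum_inv_le_log_sub_log hd K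
  rw [sub_add_cancel] at hsum hlow hupp
  rw [hT, hsum, Real.log_div (by positivity) (by positivity),
    Real.log_div (by positivity) (by positivity),
    Real.log_mul (by positivity) (by positivity), Real.log_mul (by positivity) (by positivity)]
  have h1 := harmonic_le_one_add_log K
  have h2 := eulerMascheroniConstant_add_log_le_harmonic (Nat.one_le_iff_ne_zero.mp hK)
  constructor <;> refine mul_le_mul_of_nonneg_left ?_ (by positivity) <;> linarith
end

section
/- Let K, C, Q, Q_S be natural numbers with 1 ≤ K < C and 1 ≤ Q_S ≤ Q, let ε ∈ (0,1) and let g ∈ (0, 1/2). Define T_SE := Σ_{k=0}^{K−1} CQ / (ε^{1+g}·Q_S·(K−k)·(C−k)) (the expected absorption time of the pure-birth Markov chain whose transition probability from state C_{K−k} to C_{K−k−1} is (K−k)·Q_S·(C−k)·ε^{1+g}/(CQ)). Then T_SE ≤ (CQ / (Q_S·ε^{1+g}(C−K)))·(1 + log(K(C−K+1)/(C+1))) and T_SE ≥ (CQ / (Q_S·ε^{1+g}(C−K)))·(γ + log(K(C−K)/C)), where γ is the Euler–Mascheroni constant. (The paper's Theorem 8: bounds on the expected number of iterations for trial-and-error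 learning to reach a satisfaction equilibrium for the first time.) -/
open Finset

/-- Partial fractions: a sum of `1 / (i (D + i))` in terms of harmonic numbers. -/
lemma sum_inv_mul_add_eq_harmonic (D K : ℕ) (hD : 1 ≤ D) :
    ∑ j ∈ Finset.range K, (1 : ℝ) / (((j : ℝ) + 1) * ((D : ℝ) + j + 1)) =
      ((harmonic K : ℝ) + (harmonic D : ℝ) - (harmonic (D + K) : ℝ)) / D := by
  have hD' : (0 : ℝ) < D := by exact_mod_cast hD
  induction K with
  | zero => simp
  | succ n ih =>
    rw [Finset.sum_range_succ, ih, ← add_assoc, harmonic_succ, harmonic_succ]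
    push_cast
    have h1 : (0 : ℝ) < (n : ℝ) + 1 := by positivity
    have h2 : (0 : ℝ) < (D : ℝ) + n + 1 := by positivity
    field_simp
    ring

lemma harmonic_add_sub_le_one_add_log (D K : ℕ) (hK : 1 ≤ K) :
    (harmonic K : ℝ) + (harmonic D : ℝ) - (harmonic (D + K) : ℝ) ≤
      1 + Real.log ((K : ℝ) * ((D : ℝ) + 1) / ((D : ℝ) + K + 1)) := by
  have hK' : (0 : ℝ) < K := by exact_mod_cast hK
  have h1 := harmonic_le_one_add_log K
  have h2 := Real.strictMono_eulerMascheroniSeq.monotone (Nat.le_add_right D K)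
  simp only [Real.eulerMascheroniSeq] at h2
  push_cast at h2
  rw [Real.log_div (by positivity) (by positivity), Real.log_mul (by positivity) (by positivity)]
  linarith

lemma eulerMascheroniConstant_add_log_le_harmonic_add_sub (D K : ℕ) (hD : 1 ≤ D) (hK : 1 ≤ K) :
    Real.eulerMascheroniConstant + Real.log ((K : ℝ) * D / ((D : ℝ) + K)) ≤
      (harmonic K : ℝ) + (harmonic D : ℝ) - (harmonic (D + K) : ℝ) := by
  have hK' : (0 : ℝ) < K := by exact_mod_cast hK
  have hD' : (0 : ℝ) < D := by exact_mod_cast hD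
  have h1 := Real.eulerMascheroniConstant_lt_eulerMascheroniSeq' K
  have h2 := Real.strictAnti_eulerMascheroniSeq'.antitone (Nat.le_add_right D K)
  rw [Real.eulerMascheroniSeq', if_neg (by omega)] at h1 h2
  rw [Real.eulerMascheroniSeq', if_neg (by omega)] at h2
  push_cast at h2
  rw [Real.log_div (by positivity) (by positivity), Real.log_mul (by positivity) (by positivity)]
  linarith

/-- paper's Theorem 8: bounds on the expected absorption time of the
pure-birth Markov chain approximating trial-and-error learning until a satisfaction
equilibrium is reached for the first time. -/
theorem stmt12
    (K C Q QS : ℕ) (hK : 1 ≤ K) (hKC : K < C) (hQS : 1 ≤ QS) (hQSQ : QS ≤ Q)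
    (ε : ℝ) (hε0 : 0 < ε) (hε1 : ε < 1)
    (g : ℝ) (hg0 : 0 < g) (hg1 : g < 1 / 2)
    (TSE : ℝ)
    (hT : TSE = ∑ k ∈ Finset.range K,
      (C : ℝ) * Q / (ε ^ ((1 : ℝ) + g) * QS * ((K : ℝ) - k) * ((C : ℝ) - k))) :
    TSE ≤ (C : ℝ) * Q / ((QS : ℝ) * ε ^ ((1 : ℝ) + g) * ((C : ℝ) - K)) *
        (1 + Real.log ((K : ℝ) * ((C : ℝ) - K + 1) / ((C : ℝ) + 1))) ∧
      (C : ℝ) * Q / ((QS : ℝ) * ε ^ ((1 : ℝ) + g) * ((C : ℝ) - K)) *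
        (Real.eulerMascheroniConstant + Real.log ((K : ℝ) * ((C : ℝ) - K) / C)) ≤ TSE := by
  obtain ⟨D, rfl⟩ := Nat.exists_eq_add_of_lt hKC
  obtain ⟨D, hD, hC⟩ : ∃ D' : ℕ, 1 ≤ D' ∧ K + D + 1 = D' + K := ⟨D + 1, by omega, by omega⟩
  rw [hC] at hT ⊢
  have hD' : (0 : ℝ) < D := by exact_mod_cast hD
  have hQS' : (0 : ℝ) < QS := by exact_mod_cast hQS
  have hp : 0 < ε ^ ((1 : ℝ) + g) := Real.rpow_pos_of_pos hε0 _
  have hsum : TSE = ((D + K : ℕ) : ℝ) * Q / ((QS : ℝ) * ε ^ ((1 : ℝ) + g) * D) *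
      ((harmonic K : ℝ) + (harmonic D : ℝ) - (harmonic (D + K) : ℝ)) := by
    have hS : TSE = ((D + K : ℕ) : ℝ) * Q / ((QS : ℝ) * ε ^ ((1 : ℝ) + g)) *
        ∑ j ∈ Finset.range K, (1 : ℝ) / (((j : ℝ) + 1) * ((D : ℝ) + j + 1)) := by
      rw [hT, ← Finset.sum_range_reflect, Finset.mul_sum]
      refine Finset.sum_congr rfl fun j hj => ?_
      have hj' : j + 1 ≤ K := Finset.mem_range.mp hj
      have hcast : ((K - 1 - j : ℕ) : ℝ) = (K : ℝ) - (j + 1) := by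
        rw [Nat.sub_sub, add_comm 1 j, Nat.cast_sub hj']
        push_cast
        ring
      rw [hcast, div_mul_div_comm, mul_one]
      push_cast
      congr 1
      ring
    rw [hS, sum_inv_mul_add_eq_harmonic D K hD, ← mul_div_assoc, div_mul_eq_mul_div,
      div_mul_eq_mul_div, div_div]
  have hcoef : 0 ≤ ((D + K : ℕ) : ℝ) * Q / ((QS : ℝ) * ε ^ ((1 : ℝ) + g) * D) := by positivity
  have hsub : ((D + K : ℕ) : ℝ) - K = D := by push_cast; ring
  rw [hsum, hsub]
  refine ⟨mul_le_mul_of_nonneg_left ?_ hcoef, mul_le_mul_of_nonneg_left ?_ hcoef⟩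
  · simpa using harmonic_add_sub_le_one_add_log D K hK
  · simpa using eulerMascheroniConstant_add_log_le_harmonic_add_sub D K hD hK
end
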